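/- Every β-acyclic CNF formula F can be computed by a decision-DNNF of size O(size(F)), where size(F) is the sum over clauses of the number of variables in the clause. -/

import Mathlib

/-- Labels of the gates of an NNF circuit: literals (a variable together with a
polarity), boolean constants, ∧-gates and ∨-gates. -/
inductive GateLabel (V : Type*) where
  | lit (x : V) (b : Bool)
  | const (b : Bool)
  | and
  | or

/-- An NNF circuit: a DAG whose gates are indexed by `Fin size`, wires go from
smaller indices to larger ones, inputs are labeled by literals or constants and
internal gates by ∧ or ∨, with a distinguished output gate. -/
structure NNFCircuit (V : Type*) where
  size : ℕ
  label : Fin size → GateLabel V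
  wires : Fin size → List (Fin size)
  wiresLt : ∀ i : Fin size, ∀ j ∈ wires i, (j : ℕ) < (i : ℕ)
  inputsOk : ∀ i : Fin size,
    (label i = GateLabel.and ∨ label i = GateLabel.or) ∨ wires i = []
  output : Fin size

namespace NNFCircuit

variable {V : Type*}

/-- The boolean value computed at gate `i` under assignment `τ`. -/
def eval (C : NNFCircuit V) (τ : V → Bool) (i : Fin C.size) : Bool :=
  match C.label i with
  | .lit x b => τ x == b
  | .const b => b
  | .and => (C.wires i).attach.all fun j => C.eval τ j.1
  | .or => (C.wires i).attach.any fun j => C.eval τ j.1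
termination_by (i : ℕ)
decreasing_by all_goals exact C.wiresLt i j.1 j.2

/-- The set of variables appearing in the subcircuit rooted at gate `i`. -/
def vars [DecidableEq V] (C : NNFCircuit V) (i : Fin C.size) : Finset V :=
  match C.label i with
  | .lit x _ => {x}
  | .const _ => ∅
  | .and => (C.wires i).attach.foldr (fun j acc => C.vars j.1 ∪ acc) ∅
  | .or => (C.wires i).attach.foldr (fun j acc => C.vars j.1 ∪ acc) ∅
termination_by (i : ℕ)
decreasing_by all_goals exact C.wiresLt i j.1 j.2

/-- A circuit is a DNNF if every ∧-gate is decomposable: the subcircuits rooted at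
its distinct inputs have pairwise disjoint sets of variables. -/
def IsDNNF [DecidableEq V] (C : NNFCircuit V) : Prop :=
  ∀ i : Fin C.size, C.label i = .and →
    ∀ j ∈ C.wires i, ∀ k ∈ C.wires i, j ≠ k → Disjoint (C.vars j) (C.vars k)

/-- Gate `i` is a decision gate: it is a binary ∨-gate of the form
`(x ∧ v₁) ∨ (¬x ∧ v₂)` for some variable `x`. -/
def IsDecisionGate (C : NNFCircuit V) (i : Fin C.size) : Prop :=
  ∃ (x : V) (a b pa va pb vb : Fin C.size),
    C.wires i = [a, b] ∧
    C.label a = .and ∧ C.label b = .and ∧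
    C.wires a = [pa, va] ∧ C.wires b = [pb, vb] ∧
    C.label pa = .lit x true ∧ C.label pb = .lit x false

/-- A decision-DNNF: a DNNF in which every ∨-gate is a decision gate. -/
def IsDecDNNF [DecidableEq V] (C : NNFCircuit V) : Prop :=
  C.IsDNNF ∧ ∀ i : Fin C.size, C.label i = .or → C.IsDecisionGate i

end NNFCircuit

/-- The linear order on `V` is a β-elimination order for the hypergraph `H`. -/
def IsBetaElim {V : Type*} [LinearOrder V] (H : Finset (Finset V)) : Prop :=
  ∀ x : V, ∀ e ∈ H, ∀ f ∈ H, x ∈ e → x ∈ f →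
    (e.filter fun y => x < y) ⊆ f ∨ (f.filter fun y => x < y) ⊆ e


namespace BetaAc

open Relation

abbrev Cl (V : Type*) := Finset (V × Bool)

section Comb

variable {V : Type*} [LinearOrder V]

/-- variables of a clause -/
def vs (c : Cl V) : Finset V := c.image Prod.fst

lemma mem_vs_of {c : Cl V} {l : V × Bool} (h : l ∈ c) : l.1 ∈ vs c :=
  Finset.mem_image_of_mem _ h

/-- prop form of beta elimination -/
def Beta (F : Finset (Cl V)) : Prop :=
  ∀ x : V, ∀ e ∈ F, ∀ f ∈ F, x ∈ vs e → x ∈ vs f →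
    (∀ y, x < y → y ∈ vs e → y ∈ vs f) ∨ (∀ y, x < y → y ∈ vs f → y ∈ vs e)

/-- the clause order -/
def cle (c d : Cl V) : Prop := ∀ a, a ∈ vs c → a ∉ vs d → ∃ b, b ∈ vs d ∧ b ∉ vs c ∧ a ≤ b

lemma cle_iff (c d : Cl V) : cle c d ↔ toColex (vs c) ≤ toColex (vs d) := by
  rw [Finset.Colex.toColex_le_toColex]
  rfl

lemma cle_refl (c : Cl V) : cle c c := fun _ h h' => absurd h h'

lemma cle_trans {c d e : Cl V} (h : cle c d) (h' : cle d e) : cle c e := by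
  rw [cle_iff] at *; exact le_trans h h'

lemma cle_total (c d : Cl V) : cle c d ∨ cle d c := by
  rw [cle_iff, cle_iff]; exact le_total _ _

inductive Tr (S : Cl V → Prop) : V → Cl V → Cl V → Prop
  | refl (x : V) (a : Cl V) : S a → Tr S x a a
  | join (x z : V) (a c d b : Cl V) : z ≤ x → Tr S z a c → z ∈ vs c → z ∈ vs d →
      Tr S z d b → Tr S x a b

lemma Tr.snoc {S : Cl V → Prop} {x : V} {a b : Cl V} (h : Tr S x a b) :
    ∀ {z : V} {c : Cl V}, z ≤ x → z ∈ vs b → z ∈ vs c → S c → Tr S x a c := by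
  induction h with
  | refl x a ha =>
    intro z c hz hb hc hS
    exact Tr.join x z a a c c hz (Tr.refl _ _ ha) hb hc (Tr.refl _ _ hS)
  | join x w a c d b hw h1 hc hd h2 ih1 ih2 =>
    intro z e hz hb he hS
    rcases le_total z w with hzw | hwz
    · exact Tr.join x w a c d e hw h1 hc hd (ih2 hzw hb he hS)
    · exact Tr.join x z a b e e hz (Tr.join z w a c d b hwz h1 hc hd h2) hb he (Tr.refl _ _ hS)

lemma Tr.bound {S : Cl V → Prop} {F : Finset (Cl V)} (hF : Beta F) (hS : ∀ c, S c → c ∈ F)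
    {x : V} {a b : Cl V} (h : Tr S x a b) :
    ∃ m, S m ∧ (∀ z, x ≤ z → z ∈ vs a → z ∈ vs m) ∧ (∀ z, x ≤ z → z ∈ vs b → z ∈ vs m) := by
  induction h with
  | refl x a ha => exact ⟨a, ha, fun _ _ h => h, fun _ _ h => h⟩
  | join x w a c d b hw h1 hc hd h2 ih1 ih2 =>
    obtain ⟨m1, s1, ha, hc'⟩ := ih1
    obtain ⟨m2, s2, hd', hb⟩ := ih2
    have w1 := hc' w le_rfl hc
    have w2 := hd' w le_rfl hd
    rcases hF w m1 (hS _ s1) m2 (hS _ s2) w1 w2 with h | h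
    · refine ⟨m2, s2, fun z hz hza => ?_, fun z hz hzb => hb z (hw.trans hz) hzb⟩
      rcases (hw.trans hz).eq_or_lt with rfl | hlt
      · exact w2
      · exact h z hlt (ha z hlt.le hza)
    · refine ⟨m1, s1, fun z hz hza => ha z (hw.trans hz) hza, fun z hz hzb => ?_⟩
      rcases (hw.trans hz).eq_or_lt with rfl | hlt
      · exact w1
      · exact h z hlt (hb z hlt.le hzb)

def Stp (F : Finset (Cl V)) (n : Cl V × V) (c d : Cl V) : Prop :=
  d ∈ F ∧ cle d n.1 ∧ ∃ z, z ≤ n.2 ∧ z ∈ vs c ∧ z ∈ vs d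

def InH (F : Finset (Cl V)) (n : Cl V × V) (g : Cl V) : Prop :=
  ReflTransGen (Stp F n) n.1 g

lemma InH.mem {F : Finset (Cl V)} {n : Cl V × V} {g : Cl V} (hn : n.1 ∈ F) (h : InH F n g) :
    g ∈ F ∧ cle g n.1 := by
  unfold InH at h
  induction h with
  | refl => exact ⟨hn, cle_refl _⟩
  | tail _ h _ => exact ⟨h.1, h.2.1⟩

/-- key theorem: large variables of `H_e^x` are in `e`. -/
lemma InH.key {F : Finset (Cl V)} (hF : Beta F) {n : Cl V × V} {g : Cl V} (hn : n.1 ∈ F)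
    (h : InH F n g) {z : V} (hz : n.2 ≤ z) (hzg : z ∈ vs g) : z ∈ vs n.1 := by
  have hT : Tr (fun c => c ∈ F ∧ cle c n.1) n.2 n.1 g := by
    clear hzg
    unfold InH at h
    induction h with
    | refl => exact Tr.refl _ _ ⟨hn, cle_refl _⟩
    | tail _ h ih =>
      obtain ⟨h1, h2, z, hz, hzb, hzc⟩ := h
      exact Tr.snoc ih hz hzb hzc ⟨h1, h2⟩
  obtain ⟨m, ⟨_, hm⟩, h1, h2⟩ := hT.bound hF (fun c h => h.1)
  by_contra hne
  obtain ⟨b, hb, hbm, hzb⟩ := hm z (h2 z hz hzg) hne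
  exact hbm (h1 b (hz.trans hzb) hb)

lemma laminar {α : Type*} (U : Finset α) (r D : α → α → Prop)
    (hrefl : ∀ a, r a a) (htr : ∀ a b c, r a b → r b c → r a c)
    (hD : ∀ a b, D a b → D b a)
    (htri : ∀ a ∈ U, ∀ b ∈ U, r a b ∨ r b a ∨ D a b) :
    ∃ M, M ⊆ U ∧ (∀ u ∈ U, ∃ f ∈ M, r u f) ∧ ∀ a ∈ M, ∀ b ∈ M, a ≠ b → D a b := by
  classical
  induction U using Finset.induction_on with
  | empty => exact ⟨∅, by simp, by simp, by simp⟩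
  | insert a U ha ih =>
    obtain ⟨M, hM, hc, hp⟩ := ih (fun x hx y hy =>
      htri x (Finset.mem_insert_of_mem hx) y (Finset.mem_insert_of_mem hy))
    by_cases hex : ∃ f ∈ M, r a f
    · refine ⟨M, hM.trans (Finset.subset_insert _ _), ?_, hp⟩
      intro u hu
      rcases Finset.mem_insert.1 hu with rfl | hu
      · exact hex
      · exact hc u hu
    · push Not at hex
      have key : ∀ f ∈ M, ¬ r f a → D a f := by
        intro f hf hfa
        rcases htri a (Finset.mem_insert_self _ _) f (Finset.mem_insert_of_mem (hM hf)) with h | h | h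
        · exact absurd h (hex f hf)
        · exact absurd h hfa
        · exact h
      refine ⟨insert a (M.filter fun f => ¬ r f a), ?_, ?_, ?_⟩
      · intro u hu
        simp only [Finset.mem_insert, Finset.mem_filter] at hu ⊢
        rcases hu with h | h
        · exact Or.inl h
        · exact Or.inr (hM h.1)
      · intro u hu
        rcases Finset.mem_insert.1 hu with rfl | hu
        · exact ⟨u, Finset.mem_insert_self _ _, hrefl _⟩
        · obtain ⟨f, hf, hr⟩ := hc u hu
          by_cases hfa : r f a
          · exact ⟨a, Finset.mem_insert_self _ _, htr _ _ _ hr hfa⟩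
          · exact ⟨f, by simp [hf, hfa], hr⟩
      · intro u hu v hv huv
        simp only [Finset.mem_insert, Finset.mem_filter] at hu hv
        rcases hu with rfl | hu <;> rcases hv with rfl | hv
        · exact absurd rfl huv
        · exact key v hv.1 hv.2
        · exact hD _ _ (key u hu.1 hu.2)
        · exact hp u hu.1 v hv.1 huv

def Sat (σ : V → Bool) (g : Cl V) : Prop := ∃ l ∈ g, σ l.1 = l.2

def ngv (e : Cl V) (z : V) : Bool := decide ((z, false) ∈ e)

def Spec (F : Finset (Cl V)) (n : Cl V × V) (τ : V → Bool) : Prop :=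
  ∀ g, InH F n g → Sat (fun z => if z ≤ n.2 then τ z else ngv n.1 z) g

def NV (F : Finset (Cl V)) (n : Cl V × V) (z : V) : Prop :=
  z ≤ n.2 ∧ ∃ g, InH F n g ∧ z ∈ vs g

lemma Sat.congr {σ σ' : V → Bool} {g : Cl V} (h : ∀ z ∈ vs g, σ z = σ' z) (hs : Sat σ g) :
    Sat σ' g := by
  obtain ⟨l, hl, h1⟩ := hs
  exact ⟨l, hl, by rw [← h _ (mem_vs_of hl), h1]⟩

lemma ngv_eq {e : Cl V} (hnt : ∀ x, ¬ ((x, true) ∈ e ∧ (x, false) ∈ e)) {z : V} (hz : z ∈ vs e)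
    {b : Bool} (hb : ∀ l ∈ e, l.1 = z → b ≠ l.2) : ngv e z = b := by
  obtain ⟨⟨z', p⟩, hl, rfl⟩ := Finset.mem_image.1 hz
  have h1 := hb _ hl rfl
  have h2 := hnt z'
  unfold ngv
  cases p <;> cases b <;> simp_all

/-- absorbing -/
lemma absorb {F : Finset (Cl V)} (hF : Beta F) {Q : V → Prop} {n : Cl V × V} (hn : n.1 ∈ F)
    (hmax : ∀ z ∈ vs n.1, Q z → z ≤ n.2) {c d : Cl V} (hc : InH F n c) (hd : d ∈ F)
    (hdn : cle d n.1) {z : V} (hQ : Q z) (hzc : z ∈ vs c) (hzd : z ∈ vs d) : InH F n d := by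
  have hz : z ≤ n.2 := by
    rcases le_total z n.2 with h | h
    · exact h
    · exact hmax z (hc.key hF hn h hzc) hQ
  exact ReflTransGen.tail hc ⟨hd, hdn, z, hz, hzc, hzd⟩

lemma nested {F : Finset (Cl V)} (hF : Beta F) {Q : V → Prop} (hQ : ∀ y z, z ≤ y → Q y → Q z)
    {n n' : Cl V × V} (hn : n.1 ∈ F) (hn' : n'.1 ∈ F) (hQn : Q n.2)
    (hmax' : ∀ z ∈ vs n'.1, Q z → z ≤ n'.2) (hle : cle n.1 n'.1) {h : Cl V} (hh : InH F n h) :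
    InH F n' n.1 ↔ InH F n' h := by
  unfold InH at hh
  induction hh with
  | refl => rfl
  | tail hb hs ih =>
    rename_i b c
    obtain ⟨h1, h2, z, hz, hzb, hzc⟩ := hs
    have hb' : b ∈ F ∧ cle b n.1 := InH.mem hn hb
    rw [ih]
    constructor
    · intro h; exact absorb hF hn' hmax' h h1 (cle_trans h2 hle) (hQ _ _ hz hQn) hzb hzc
    · intro h; exact absorb hF hn' hmax' h hb'.1 (cle_trans hb'.2 hle) (hQ _ _ hz hQn) hzc hzb

lemma tricho {F : Finset (Cl V)} (hF : Beta F) {Q : V → Prop} (hQ : ∀ y z, z ≤ y → Q y → Q z)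
    {n n' : Cl V × V} (hn : n.1 ∈ F) (hn' : n'.1 ∈ F) (hQn : Q n.2)
    (hmax' : ∀ z ∈ vs n'.1, Q z → z ≤ n'.2) (hle : cle n.1 n'.1) :
    (∀ g, InH F n g → InH F n' g) ∨ (∀ z, NV F n z → NV F n' z → False) := by
  by_cases hd : ∀ z, NV F n z → NV F n' z → False
  · exact Or.inr hd
  left
  push Not at hd
  obtain ⟨z, ⟨hz, g, hg, hzg⟩, ⟨hz', g', hg', hzg'⟩, -⟩ := hd
  have hgm := hg.mem hn
  have : InH F n' g := absorb hF hn' hmax' hg' hgm.1 (cle_trans hgm.2 hle) (hQ _ _ hz hQn) hzg' hzg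
  have h0 := (nested hF hQ hn hn' hQn hmax' hle hg).2 this
  intro k hk
  exact (nested hF hQ hn hn' hQn hmax' hle hk).1 h0

open Classical in
lemma and_step {F : Finset (Cl V)} (hF : Beta F)
    (hnt : ∀ C ∈ F, ∀ x : V, ¬ ((x, true) ∈ C ∧ (x, false) ∈ C))
    (Q : V → Prop) (hQ : ∀ y z, z ≤ y → Q y → Q z) (ρ : V → Bool) (W : Cl V → Prop)
    (hWF : ∀ g, W g → g ∈ F)
    (hW : ∀ n g, W n.1 → Q n.2 → InH F n g → W g) :
    ∃ (ok : Bool) (M : Finset (Cl V × V)),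
      (∀ n ∈ M, n.1 ∈ F ∧ n.2 ∈ vs n.1 ∧ Q n.2) ∧
      (∀ n ∈ M, ∀ n' ∈ M, n ≠ n' → ∀ z, NV F n z → NV F n' z → False) ∧
      (∀ n ∈ M, ∀ z, NV F n z → Q z ∧ ∃ g, W g ∧ z ∈ vs g) ∧
      ∀ τ : V → Bool, (∀ g, W g → Sat (fun z => if Q z then τ z else ρ z) g) ↔
        (ok = true ∧ ∀ n ∈ M, Spec F n τ) := by
  by_cases hbad : ∃ f, W f ∧ (∀ l ∈ f, ρ l.1 ≠ l.2) ∧ ∀ z ∈ vs f, ¬ Q z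
  · obtain ⟨f, hf, h1, h2⟩ := hbad
    refine ⟨false, ∅, by simp, by simp, by simp, ?_⟩
    intro τ
    simp only [Bool.false_eq_true, false_and, iff_false]
    intro h
    obtain ⟨l, hl, h3⟩ := h f hf
    simp only [h2 _ (mem_vs_of hl), if_false] at h3
    exact h1 l hl h3
  push Not at hbad
  let U : Finset (Cl V × V) := (F ×ˢ F.biUnion vs).filter fun n =>
    W n.1 ∧ (∀ l ∈ n.1, ¬ Q l.1 → ρ l.1 ≠ l.2) ∧ n.2 ∈ vs n.1 ∧ Q n.2 ∧
      ∀ z ∈ vs n.1, Q z → z ≤ n.2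
  have hU : ∀ n, n ∈ U ↔ W n.1 ∧ (∀ l ∈ n.1, ¬ Q l.1 → ρ l.1 ≠ l.2) ∧ n.2 ∈ vs n.1 ∧ Q n.2 ∧
      ∀ z ∈ vs n.1, Q z → z ≤ n.2 := by
    intro n
    simp only [U, Finset.mem_filter, Finset.mem_product, Finset.mem_biUnion, and_iff_right_iff_imp]
    rintro ⟨h1, -, h2, -⟩
    exact ⟨hWF _ h1, n.1, hWF _ h1, h2⟩
  have hUex : ∀ g, W g → (∀ l ∈ g, ¬ Q l.1 → ρ l.1 ≠ l.2) → ∃ y, (g, y) ∈ U := by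
    intro g hg h1
    have hne : ((vs g).filter Q).Nonempty := by
      by_contra hne
      rw [Finset.not_nonempty_iff_eq_empty, Finset.filter_eq_empty_iff] at hne
      obtain ⟨z, hz, hqz⟩ := hbad g hg (fun l hl => h1 l hl (hne (mem_vs_of hl)))
      exact hne hz hqz
    have hm := Finset.max'_mem _ hne
    rw [Finset.mem_filter] at hm
    refine ⟨((vs g).filter Q).max' hne, (hU _).2 ⟨hg, h1, hm.1, hm.2, ?_⟩⟩
    intro z hz hqz
    exact Finset.le_max' _ _ (Finset.mem_filter.2 ⟨hz, hqz⟩)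
  obtain ⟨M, hMU, hcov, hpair⟩ := laminar U (fun n n' => ∀ g, InH F n g → InH F n' g)
    (fun n n' => ∀ z, NV F n z → NV F n' z → False) (fun _ _ h => h)
    (fun _ _ _ h h' g hg => h' g (h g hg)) (fun _ _ h z h1 h2 => h z h2 h1) (by
      intro n hn n' hn'
      rw [hU] at hn hn'
      rcases cle_total n.1 n'.1 with h | h
      · rcases tricho hF hQ (hWF _ hn.1) (hWF _ hn'.1) hn.2.2.2.1 hn'.2.2.2.2 h with h | h
        · exact Or.inl h
        · exact Or.inr (Or.inr h)
      · rcases tricho hF hQ (hWF _ hn'.1) (hWF _ hn.1) hn'.2.2.2.1 hn.2.2.2.2 h with h | h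
        · exact Or.inr (Or.inl h)
        · exact Or.inr (Or.inr fun z h1 h2 => h z h2 h1))
  have agree : ∀ n ∈ U, ∀ g, InH F n g → ∀ τ : V → Bool, ∀ z ∈ vs g,
      (if Q z then τ z else ρ z) = (if z ≤ n.2 then τ z else ngv n.1 z) := by
    intro n hn g hg τ z hz
    rw [hU] at hn
    obtain ⟨h1, h2, h3, h4, h5⟩ := hn
    by_cases hzn : z ≤ n.2
    · simp [hzn, hQ _ _ hzn h4]
    · have hzf : z ∈ vs n.1 := hg.key hF (hWF _ h1) (le_of_not_ge hzn) hz
      have hq : ¬ Q z := fun hq => hzn (h5 z hzf hq)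
      simp only [hzn, hq, if_false]
      exact (ngv_eq (hnt _ (hWF _ h1)) hzf (fun l hl hlz => by
        subst hlz; exact h2 l hl hq)).symm
  refine ⟨true, M, ?_, hpair, ?_, ?_⟩
  · intro n hn
    have := (hU n).1 (hMU hn)
    exact ⟨hWF _ this.1, this.2.2.1, this.2.2.2.1⟩
  · rintro n hn z ⟨hz, g, hg, hzg⟩
    have := (hU n).1 (hMU hn)
    exact ⟨hQ _ _ hz this.2.2.2.1, g, hW n g this.1 this.2.2.2.1 hg, hzg⟩
  · intro τ
    simp only [true_and]
    constructor
    · intro h n hn g hg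
      have := (hU n).1 (hMU hn)
      exact (h g (hW n g this.1 this.2.2.2.1 hg)).congr (agree n (hMU hn) g hg τ)
    · intro h g hg
      by_cases hs : ∀ l ∈ g, ¬ Q l.1 → ρ l.1 ≠ l.2
      · obtain ⟨y, hy⟩ := hUex g hg hs
        obtain ⟨n, hn, hr⟩ := hcov _ hy
        have hgn : InH F n g := hr g ReflTransGen.refl
        exact (h n hn g hgn).congr fun z hz => (agree n (hMU hn) g hgn τ z hz).symm
      · push Not at hs
        obtain ⟨l, hl, hq, he⟩ := hs
        exact ⟨l, hl, by simp [hq, he]⟩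

/-- children of a decision node -/
lemma node_step {F : Finset (Cl V)} (hF : Beta F)
    (hnt : ∀ C ∈ F, ∀ x : V, ¬ ((x, true) ∈ C ∧ (x, false) ∈ C))
    (n : Cl V × V) (hn : n.1 ∈ F) (b : Bool) :
    ∃ (ok : Bool) (M : Finset (Cl V × V)),
      (∀ m ∈ M, m.1 ∈ F ∧ m.2 ∈ vs m.1 ∧ m.2 < n.2) ∧
      (∀ m ∈ M, ∀ m' ∈ M, m ≠ m' → ∀ z, NV F m z → NV F m' z → False) ∧
      (∀ m ∈ M, ∀ z, NV F m z → z < n.2 ∧ NV F n z) ∧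
      ∀ τ : V → Bool, τ n.2 = b → (Spec F n τ ↔ (ok = true ∧ ∀ m ∈ M, Spec F m τ)) := by
  obtain ⟨ok, M, h1, h2, h3, h4⟩ := and_step hF hnt (fun z => z < n.2)
    (fun y z h h' => lt_of_le_of_lt h h') (fun z => if z = n.2 then b else ngv n.1 z) (InH F n)
    (fun g hg => (hg.mem hn).1) (by
      intro m g hm hlt hg
      unfold InH at hg
      have hmle := (hm.mem hn).2
      induction hg with
      | refl => exact hm
      | tail _ hs ih =>
        obtain ⟨a1, a2, z, a3, a4⟩ := hs
        exact ReflTransGen.tail ih ⟨a1, cle_trans a2 hmle, z, a3.trans (le_of_lt hlt), a4⟩)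
  refine ⟨ok, M, h1, h2, fun m hm z hz => ⟨(h3 m hm z hz).1, (h3 m hm z hz).1.le, (h3 m hm z hz).2⟩, ?_⟩
  intro τ hτ
  rw [← h4 τ]
  have : (fun z => if z ≤ n.2 then τ z else ngv n.1 z) =
      fun z => if z < n.2 then τ z else if z = n.2 then b else ngv n.1 z := by
    funext z
    rcases lt_trichotomy z n.2 with h | h | h
    · simp [h, h.le]
    · simp [h, hτ]
    · simp [not_lt.2 h.le, not_le.2 h, h.ne']
  unfold Spec
  rw [this]
  apply forall_congr'; intro g
  apply imp_congr_right; intro _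
  unfold Sat
  apply exists_congr; intro l
  apply and_congr_right; intro _
  simp only
  congr!

lemma root_step {F : Finset (Cl V)} (hF : Beta F)
    (hnt : ∀ C ∈ F, ∀ x : V, ¬ ((x, true) ∈ C ∧ (x, false) ∈ C)) :
    ∃ (ok : Bool) (M : Finset (Cl V × V)),
      (∀ m ∈ M, m.1 ∈ F ∧ m.2 ∈ vs m.1) ∧
      (∀ m ∈ M, ∀ m' ∈ M, m ≠ m' → ∀ z, NV F m z → NV F m' z → False) ∧
      ∀ τ : V → Bool, (∀ C ∈ F, ∃ l ∈ C, τ l.1 = l.2) ↔ (ok = true ∧ ∀ m ∈ M, Spec F m τ) := by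
  obtain ⟨ok, M, h1, h2, h3, h4⟩ := and_step hF hnt (fun z => True)
    (fun y z h h' => h') (fun z => true) (fun g => g ∈ F)
    (fun g hg => hg) (fun m g hm _ hg => (hg.mem hm).1)
  refine ⟨ok, M, fun m hm => ⟨(h1 m hm).1, (h1 m hm).2.1⟩, h2, ?_⟩
  intro τ
  rw [← h4 τ]
  simp [Sat]

end Comb

section Circ

open NNFCircuit

variable {V : Type*}

lemma eval_lit (C : NNFCircuit V) (τ : V → Bool) (i : Fin C.size) {x : V} {b : Bool}
    (h : C.label i = .lit x b) : C.eval τ i = true ↔ τ x = b := by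
  rw [NNFCircuit.eval, h]; simp

lemma eval_const (C : NNFCircuit V) (τ : V → Bool) (i : Fin C.size) {b : Bool}
    (h : C.label i = .const b) : C.eval τ i = b := by
  rw [NNFCircuit.eval, h]

lemma eval_and (C : NNFCircuit V) (τ : V → Bool) (i : Fin C.size)
    (h : C.label i = .and) : C.eval τ i = true ↔ ∀ j ∈ C.wires i, C.eval τ j = true := by
  rw [NNFCircuit.eval, h]; simp

lemma eval_or (C : NNFCircuit V) (τ : V → Bool) (i : Fin C.size)
    (h : C.label i = .or) : C.eval τ i = true ↔ ∃ j ∈ C.wires i, C.eval τ j = true := by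
  rw [NNFCircuit.eval, h]; simp

lemma mem_foldr [DecidableEq V] {α : Type*} (f : α → Finset V) (l : List α) (z : V) :
    z ∈ l.foldr (fun j acc => f j ∪ acc) ∅ ↔ ∃ j ∈ l, z ∈ f j := by
  induction l with
  | nil => simp
  | cons a l ih => simp [ih]

lemma vars_lit [DecidableEq V] (C : NNFCircuit V) (i : Fin C.size) {x : V} {b : Bool}
    (h : C.label i = .lit x b) : C.vars i = {x} := by
  rw [NNFCircuit.vars, h]

lemma vars_const [DecidableEq V] (C : NNFCircuit V) (i : Fin C.size) {b : Bool}
    (h : C.label i = .const b) : C.vars i = ∅ := by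
  rw [NNFCircuit.vars, h]

lemma mem_vars_gate [DecidableEq V] (C : NNFCircuit V) (i : Fin C.size)
    (h : C.label i = .and ∨ C.label i = .or) (z : V) :
    z ∈ C.vars i ↔ ∃ j ∈ C.wires i, z ∈ C.vars j := by
  rcases h with h | h <;> rw [NNFCircuit.vars, h] <;> simp only <;>
    rw [mem_foldr (fun j : {x // x ∈ C.wires i} => C.vars j.1)] <;> simp

lemma exists_circuit {G L : Type*} [Fintype G] [LinearOrder L] (rank : G → L)
    (label : G → GateLabel V) (wires : G → List G)
    (hlt : ∀ g, ∀ h ∈ wires g, rank h < rank g)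
    (hin : ∀ g, (label g = .and ∨ label g = .or) ∨ wires g = []) (root : G) :
    ∃ (C : NNFCircuit V) (φ : G ≃ Fin C.size), C.size = Fintype.card G ∧ C.output = φ root ∧
      ∀ g, C.label (φ g) = label g ∧ C.wires (φ g) = (wires g).map φ := by
  let key : G → L ×ₗ Fin (Fintype.card G) := fun g => toLex (rank g, Fintype.equivFin G g)
  have hinj : Function.Injective key := by
    intro a b h
    have : (rank a, Fintype.equivFin G a) = (rank b, Fintype.equivFin G b) := toLex.injective h
    simpa using (Prod.ext_iff.1 this).2
  letI : LinearOrder G := LinearOrder.lift' key hinj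
  have hlt' : ∀ a b : G, rank a < rank b → a < b := by
    intro a b h
    change key a < key b
    exact Prod.Lex.toLex_lt_toLex.2 (Or.inl h)
  let ψ := Fintype.orderIsoFinOfCardEq G rfl
  refine ⟨⟨Fintype.card G, fun i => label (ψ i), fun i => (wires (ψ i)).map ψ.symm, ?_, ?_,
    ψ.symm root⟩, ψ.symm.toEquiv, rfl, rfl, ?_⟩
  · intro i j hj
    obtain ⟨h, hh, rfl⟩ := List.mem_map.1 hj
    have := hlt' _ _ (hlt _ _ hh)
    have h2 := ψ.symm.lt_iff_lt.2 this
    rw [OrderIso.symm_apply_apply] at h2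
    exact h2
  · intro i
    rcases hin (ψ i) with h | h
    · exact Or.inl h
    · right; simp [h]
  · intro g
    simp

/-- gates -/
inductive Gt (N : Type*) where
  | cst (n : N)
  | lit (b : Bool) (n : N)
  | inner (b : Bool) (n : N)
  | dec (b : Bool) (n : N)
  | orr (n : N)
  | rcst
  | root

def Gt.code {N : Type*} : Gt N → (N × Fin 4 × Bool) ⊕ Bool
  | .cst n => Sum.inl (n, 0, false)
  | .orr n => Sum.inl (n, 0, true)
  | .lit b n => Sum.inl (n, 1, b)
  | .inner b n => Sum.inl (n, 2, b)
  | .dec b n => Sum.inl (n, 3, b)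
  | .rcst => Sum.inr false
  | .root => Sum.inr true

lemma Gt.code_inj {N : Type*} : Function.Injective (Gt.code (N := N)) := by
  intro a b h
  cases a <;> cases b <;> simp_all [Gt.code]

noncomputable instance {N : Type*} [Fintype N] : Fintype (Gt N) :=
  Fintype.ofInjective _ Gt.code_inj

lemma Gt.card_le {N : Type*} [Fintype N] : Fintype.card (Gt N) ≤ 8 * Fintype.card N + 2 := by
  refine (Fintype.card_le_of_injective _ (Gt.code_inj (N := N))).trans ?_
  simp; omega

end Circ

section Main

variable {V : Type*} [LinearOrder V]

def nodes (F : Finset (Cl V)) : Finset (Cl V × V) :=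
  F.biUnion fun c => (vs c).image fun x => (c, x)

lemma mem_nodes {F : Finset (Cl V)} {n : Cl V × V} : n ∈ nodes F ↔ n.1 ∈ F ∧ n.2 ∈ vs n.1 := by
  obtain ⟨c, x⟩ := n
  simp only [nodes, Finset.mem_biUnion, Finset.mem_image, Prod.mk.injEq]
  constructor
  · rintro ⟨a, ha, y, hy, rfl, rfl⟩; exact ⟨ha, hy⟩
  · rintro ⟨h1, h2⟩; exact ⟨c, h1, x, h2, rfl, rfl⟩

lemma card_nodes (F : Finset (Cl V)) : (nodes F).card ≤ ∑ C ∈ F, C.card := by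
  refine Finset.card_biUnion_le.trans (Finset.sum_le_sum fun c _ => ?_)
  exact Finset.card_image_le.trans Finset.card_image_le

def gLabel {F : Finset (Cl V)} : Gt (nodes F) → GateLabel V
  | .cst _ => .const false
  | .orr _ => .or
  | .lit b n => .lit n.1.2 b
  | .inner _ _ => .and
  | .dec _ _ => .and
  | .rcst => .const false
  | .root => .and

noncomputable def kids {F : Finset (Cl V)} (M : Finset (Cl V × V)) : List (Gt (nodes F)) :=
  ((Finset.univ.filter fun m : nodes F => m.1 ∈ M).toList).map Gt.orr

lemma mem_kids {F : Finset (Cl V)} {M : Finset (Cl V × V)} {g : Gt (nodes F)} :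
    g ∈ kids M ↔ ∃ m : nodes F, m.1 ∈ M ∧ g = Gt.orr m := by
  simp only [kids, List.mem_map, Finset.mem_toList, Finset.mem_filter, Finset.mem_univ, true_and]
  exact exists_congr fun m => and_congr_right fun _ => eq_comm

noncomputable def gWires {F : Finset (Cl V)} (ok : nodes F → Bool → Bool)
    (M : nodes F → Bool → Finset (Cl V × V)) (ok0 : Bool) (M0 : Finset (Cl V × V)) :
    Gt (nodes F) → List (Gt (nodes F))
  | .cst _ => []
  | .orr n => [.dec true n, .dec false n]
  | .lit _ _ => []
  | .inner b n => kids (M n b) ++ (if ok n b = true then [] else [.cst n])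
  | .dec b n => [.lit b n, .inner b n]
  | .rcst => []
  | .root => kids M0 ++ (if ok0 = true then [] else [.rcst])

def gRank {F : Finset (Cl V)} : Gt (nodes F) → WithTop V ×ₗ ℕ
  | .cst n => toLex ((n.1.2 : WithTop V), 0)
  | .orr n => toLex ((n.1.2 : WithTop V), 3)
  | .lit _ n => toLex ((n.1.2 : WithTop V), 0)
  | .inner _ n => toLex ((n.1.2 : WithTop V), 1)
  | .dec _ n => toLex ((n.1.2 : WithTop V), 2)
  | .rcst => toLex (⊤, 0)
  | .root => toLex (⊤, 1)

theorem main (F : Finset (Cl V)) (hF : Beta F)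
    (hnt : ∀ C ∈ F, ∀ x : V, ¬ ((x, true) ∈ C ∧ (x, false) ∈ C)) :
    ∃ D : NNFCircuit V, D.IsDecDNNF ∧
        D.size ≤ 8 * (∑ C ∈ F, C.card) + 8 ∧
        ∀ τ : V → Bool,
          (D.eval τ D.output = true ↔ ∀ C ∈ F, ∃ l ∈ C, τ l.1 = l.2) := by
  obtain ⟨ok0, M0, r1, r2, r3⟩ := root_step hF hnt
  have hns := fun (n : nodes F) (b : Bool) =>
    node_step hF hnt n.1 (mem_nodes.1 n.2).1 b
  choose ok M n1 n2 n3 n4 using hns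
  obtain ⟨C, φ, hsize, hout, hφ⟩ := exists_circuit (gRank (F := F)) gLabel (gWires ok M ok0 M0)
    (by
      intro g h hh
      cases g with
      | cst n => simp [gWires] at hh
      | lit b n => simp [gWires] at hh
      | rcst => simp [gWires] at hh
      | orr n =>
        simp only [gWires, List.mem_cons, List.not_mem_nil, or_false] at hh
        rcases hh with rfl | rfl <;> simp [gRank, Prod.Lex.toLex_lt_toLex]
      | dec b n =>
        simp only [gWires, List.mem_cons, List.not_mem_nil, or_false] at hh
        rcases hh with rfl | rfl <;> simp [gRank, Prod.Lex.toLex_lt_toLex]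
      | inner b n =>
        simp only [gWires, List.mem_append, mem_kids] at hh
        rcases hh with ⟨m, hm, rfl⟩ | hh
        · have := (n1 n b _ hm).2.2
          simp [gRank, Prod.Lex.toLex_lt_toLex, this]
        · split_ifs at hh
          · simp at hh
          · simp only [List.mem_singleton] at hh
            subst hh
            simp [gRank, Prod.Lex.toLex_lt_toLex]
      | root =>
        simp only [gWires, List.mem_append, mem_kids] at hh
        rcases hh with ⟨m, hm, rfl⟩ | hh
        · simp [gRank, Prod.Lex.toLex_lt_toLex]
        · split_ifs at hh
          · simp at hh
          · simp only [List.mem_singleton] at hh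
            subst hh
            simp [gRank, Prod.Lex.toLex_lt_toLex])
    (by intro g; cases g <;> simp [gLabel, gWires]) Gt.root
  have hl : ∀ g, C.label (φ g) = gLabel g := fun g => (hφ g).1
  have hw : ∀ g, C.wires (φ g) = (gWires ok M ok0 M0 g).map φ := fun g => (hφ g).2
  -- evaluation equations
  have e_and : ∀ τ g, gLabel g = .and → (C.eval τ (φ g) = true ↔
      ∀ h ∈ gWires ok M ok0 M0 g, C.eval τ (φ h) = true) := by
    intro τ g hg
    rw [eval_and C τ _ ((hl g).trans hg), hw]
    simp
  have v_gate : ∀ g, (gLabel g = .and ∨ gLabel g = .or) → ∀ z, (z ∈ C.vars (φ g) ↔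
      ∃ h ∈ gWires ok M ok0 M0 g, z ∈ C.vars (φ h)) := by
    intro g hg z
    rw [mem_vars_gate C _ (by rwa [hl g]), hw]
    simp
  have v_dec : ∀ n b z, z ∈ C.vars (φ (.dec b n)) → z = n.1.2 ∨ z ∈ C.vars (φ (.inner b n)) := by
    intro n b z hz
    rw [v_gate _ (Or.inl rfl)] at hz
    obtain ⟨h, hh, hz⟩ := hz
    simp only [gWires, List.mem_cons, List.not_mem_nil, or_false] at hh
    rcases hh with rfl | rfl
    · rw [vars_lit C _ (hl _)] at hz
      left; simpa using hz
    · exact Or.inr hz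
  have v_inner : ∀ n b z, z ∈ C.vars (φ (.inner b n)) →
      ∃ m : nodes F, m.1 ∈ M n b ∧ z ∈ C.vars (φ (.orr m)) := by
    intro n b z hz
    rw [v_gate _ (Or.inl rfl)] at hz
    obtain ⟨h, hh, hz⟩ := hz
    simp only [gWires, List.mem_append, mem_kids] at hh
    rcases hh with ⟨m, hm, rfl⟩ | hh
    · exact ⟨m, hm, hz⟩
    · split_ifs at hh
      · simp at hh
      · simp only [List.mem_singleton] at hh
        subst hh
        rw [vars_const C _ (hl _)] at hz
        simp at hz
  have ev_kids : ∀ τ (b : Bool) (M' : Finset (Cl V × V)) (k : Gt (nodes F)),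
      gLabel k = .const false →
      ((∀ h ∈ kids M' ++ (if b = true then [] else [k]), C.eval τ (φ h) = true) ↔
        (b = true ∧ ∀ m : nodes F, m.1 ∈ M' → C.eval τ (φ (.orr m)) = true)) := by
    intro τ b M' k hk
    have hk' := eval_const C τ (φ k) ((hl k).trans hk)
    simp only [List.mem_append, mem_kids]
    constructor
    · intro h
      refine ⟨?_, fun m hm => h _ (Or.inl ⟨m, hm, rfl⟩)⟩
      by_contra hb
      have := h k (Or.inr (by simp [hb]))
      rw [hk'] at this
      simp at this
    · rintro ⟨rfl, h⟩ g (⟨m, hm, rfl⟩ | hg)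
      · exact h m hm
      · simp at hg
  have spec : ∀ n : nodes F, (∀ τ, C.eval τ (φ (.orr n)) = true ↔ Spec F n.1 τ) ∧
      ∀ z ∈ C.vars (φ (.orr n)), NV F n.1 z := by
    have wf : WellFounded (fun a b : nodes F => a.1.2 < b.1.2) := by
      haveI : IsTrans (nodes F) (fun a b => a.1.2 < b.1.2) := ⟨fun _ _ _ h h' => lt_trans h h'⟩
      haveI : Std.Irrefl (fun a b : nodes F => a.1.2 < b.1.2) := ⟨fun a h => lt_irrefl _ h⟩
      exact Finite.wellFounded_of_trans_of_irrefl _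
    intro n
    induction n using wf.induction with
    | _ n ih =>
    have ih' : ∀ b, ∀ m : nodes F, m.1 ∈ M n b →
        (∀ τ, C.eval τ (φ (.orr m)) = true ↔ Spec F m.1 τ) ∧
        ∀ z ∈ C.vars (φ (.orr m)), NV F m.1 z :=
      fun b m hm => ih m (n1 n b _ hm).2.2
    constructor
    · intro τ
      have hdec : ∀ b, C.eval τ (φ (.dec b n)) = true ↔ (τ n.1.2 = b ∧ Spec F n.1 τ) := by
        intro b
        rw [e_and τ _ rfl]
        simp only [gWires, List.mem_cons, List.not_mem_nil, or_false, forall_eq_or_imp, forall_eq]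
        rw [eval_lit C τ _ (hl _)]
        apply and_congr_right
        intro hb
        rw [e_and τ _ rfl, n4 n b τ hb]
        simp only [gWires]
        rw [ev_kids τ _ _ _ rfl]
        apply and_congr_right
        intro _
        constructor
        · intro h m hm
          have := n1 n b m hm
          exact ((ih' b ⟨m, mem_nodes.2 ⟨this.1, this.2.1⟩⟩ hm).1 τ).1 (h _ hm)
        · intro h m hm
          exact ((ih' b m hm).1 τ).2 (h _ hm)
      rw [eval_or C τ _ (hl _), hw]
      simp only [gWires, List.map_cons, List.map_nil, List.mem_cons, List.not_mem_nil, or_false,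
        exists_eq_or_imp, exists_eq_left, hdec]
      cases τ n.1.2 <;> simp
    · intro z hz
      rw [v_gate _ (Or.inr rfl)] at hz
      obtain ⟨h, hh, hz⟩ := hz
      have : ∃ b, h = .dec b n := by
        simp only [gWires, List.mem_cons, List.not_mem_nil, or_false] at hh
        rcases hh with rfl | rfl
        · exact ⟨_, rfl⟩
        · exact ⟨_, rfl⟩
      obtain ⟨b, rfl⟩ := this
      rcases v_dec n b z hz with rfl | hz
      · exact ⟨le_rfl, n.1.1, Relation.ReflTransGen.refl, (mem_nodes.1 n.2).2⟩
      · obtain ⟨m, hm, hz⟩ := v_inner n b z hz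
        exact (n3 n b _ hm z ((ih' b m hm).2 z hz)).2
  have dis_kids : ∀ (b : Bool) (M' : Finset (Cl V × V)) (k : Gt (nodes F)),
      gLabel k = .const false →
      (∀ m ∈ M', ∀ m' ∈ M', m ≠ m' → ∀ z, NV F m z → NV F m' z → False) →
      ∀ g ∈ kids M' ++ (if b = true then [] else [k]),
      ∀ h ∈ kids M' ++ (if b = true then [] else [k]), g ≠ h →
        Disjoint (C.vars (φ g)) (C.vars (φ h)) := by
    intro b M' k hk hd g hg h hh hne
    have hk' := vars_const C (φ k) ((hl k).trans hk)
    have aux : ∀ g ∈ kids M' ++ (if b = true then [] else [k]),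
        (∃ m : nodes F, m.1 ∈ M' ∧ g = .orr m) ∨ g = k := by
      intro g hg
      rw [List.mem_append, mem_kids] at hg
      rcases hg with hg | hg
      · exact Or.inl hg
      · split_ifs at hg
        · simp at hg
        · right; simpa using hg
    rcases aux g hg with ⟨m, hm, rfl⟩ | rfl
    · rcases aux h hh with ⟨m', hm', rfl⟩ | rfl
      · rw [Finset.disjoint_left]
        intro z hz hz'
        refine hd m.1 hm m'.1 hm' ?_ z ((spec m).2 z hz) ((spec m').2 z hz')
        intro he
        exact hne (by rw [Subtype.ext he])
      · rw [hk']; exact Finset.disjoint_empty_right _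
    · rw [hk']; exact Finset.disjoint_empty_left _
  have dis : ∀ g, gLabel g = .and → ∀ h ∈ gWires ok M ok0 M0 g, ∀ k ∈ gWires ok M ok0 M0 g,
      h ≠ k → Disjoint (C.vars (φ h)) (C.vars (φ k)) := by
    intro g hg
    cases g with
    | cst n => simp [gLabel] at hg
    | lit b n => simp [gLabel] at hg
    | rcst => simp [gLabel] at hg
    | orr n => simp [gLabel] at hg
    | inner b n => exact dis_kids _ _ _ rfl (n2 n b)
    | root => exact dis_kids _ _ _ rfl r2
    | dec b n =>
      have key : Disjoint (C.vars (φ (.lit b n))) (C.vars (φ (.inner b n))) := by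
        rw [vars_lit C _ (hl _), Finset.disjoint_singleton_left]
        intro hz
        obtain ⟨m, hm, hz⟩ := v_inner n b _ hz
        exact lt_irrefl _ (n3 n b _ hm _ ((spec m).2 _ hz)).1
      intro h hh k hk hne
      simp only [gWires, List.mem_cons, List.not_mem_nil, or_false] at hh hk
      rcases hh with rfl | rfl <;> rcases hk with rfl | rfl
      · exact absurd rfl hne
      · exact key
      · exact key.symm
      · exact absurd rfl hne
  refine ⟨C, ⟨?_, ?_⟩, ?_, ?_⟩
  · intro i hi j hj k hk hne
    obtain ⟨g, rfl⟩ := φ.surjective i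
    rw [hw] at hj hk
    obtain ⟨h, hh, rfl⟩ := List.mem_map.1 hj
    obtain ⟨h', hh', rfl⟩ := List.mem_map.1 hk
    exact dis g ((hl g).symm.trans hi) h hh h' hh' (fun he => hne (by rw [he]))
  · intro i hi
    obtain ⟨g, rfl⟩ := φ.surjective i
    rw [hl] at hi
    cases g with
    | orr n =>
      exact ⟨n.1.2, φ (.dec true n), φ (.dec false n), φ (.lit true n), φ (.inner true n),
        φ (.lit false n), φ (.inner false n), hw _, hl _, hl _, hw _, hw _, hl _, hl _⟩
    | _ => simp [gLabel] at hi
  · rw [hsize]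
    refine Gt.card_le.trans ?_
    have := card_nodes F
    rw [Fintype.card_coe]
    omega
  · intro τ
    rw [hout, e_and τ _ rfl, r3 τ]
    simp only [gWires]
    rw [ev_kids τ _ _ _ rfl]
    apply and_congr_right
    intro _
    constructor
    · intro h m hm
      exact ((spec ⟨m, mem_nodes.2 (r1 m hm)⟩).1 τ).1 (h _ hm)
    · intro h m hm
      exact ((spec m).1 τ).2 (h _ hm)

end Main

end BetaAc

/-- Every β-acyclic CNF formula `F` (a set of non-tautological clauses, a clause
being a set of variable/polarity pairs) is computed by a decision-DNNF of size
`O(size F)`. -/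
theorem betaAcyclic_decDNNF :
    ∃ c : ℕ, ∀ (V : Type) [DecidableEq V] (F : Finset (Finset (V × Bool))),
      (∀ C ∈ F, ∀ x : V, ¬ ((x, true) ∈ C ∧ (x, false) ∈ C)) →
      (∃ lo : LinearOrder V,
        @IsBetaElim V lo (F.image fun C => C.image Prod.fst)) →
      ∃ D : NNFCircuit V, D.IsDecDNNF ∧
        D.size ≤ c * (∑ C ∈ F, C.card) + c ∧
        ∀ τ : V → Bool,
          (D.eval τ D.output = true ↔ ∀ C ∈ F, ∃ l ∈ C, τ l.1 = l.2) := by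


  refine ⟨8, ?_⟩
  intro V inst F hnt hex
  obtain ⟨lo, h⟩ := hex
  have hi : inst = lo.toDecidableEq := Subsingleton.elim _ _
  subst hi
  refine BetaAc.main F ?_ hnt
  intro x e he f hf hxe hxf
  rcases h x _ (Finset.mem_image_of_mem _ he) _ (Finset.mem_image_of_mem _ hf) hxe hxf with h | h
  · exact Or.inl fun y hy hye => h (Finset.mem_filter.2 ⟨hye, hy⟩)
  · exact Or.inr fun y hy hye => h (Finset.mem_filter.2 ⟨hye, hy⟩)
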